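/- In the near-separable setting with m = r, assume r ≥ 2 and ε ≤ σ_min(W)/(8 r √r). Then any optimal solution A* of the minimum-volume-ellipsoid SDP associated with M̃ satisfies λ_max(Wᵀ A* W) ≤ 4. -/

import Mathlib

open Matrix BigOperators

/-- Euclidean norm of a vector in `ℝ^m`. -/
noncomputable def colNorm {m : ℕ} (v : Fin m → ℝ) : ℝ := Real.sqrt (∑ i, (v i) ^ 2)

/-- Largest singular value of a matrix. -/
noncomputable def sigmaMax {m n : ℕ} (X : Matrix (Fin m) (Fin n) ℝ) : ℝ :=
  sSup {c : ℝ | ∃ v : Fin n → ℝ, colNorm v = 1 ∧ c = colNorm (X.mulVec v)}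

/-- Smallest singular value of a matrix. -/
noncomputable def sigmaMin {m n : ℕ} (X : Matrix (Fin m) (Fin n) ℝ) : ℝ :=
  sInf {c : ℝ | ∃ v : Fin n → ℝ, colNorm v = 1 ∧ c = colNorm (X.mulVec v)}

/-- Condition number `κ(X) = σ_max(X) / σ_min(X)`. -/
noncomputable def kappa {m n : ℕ} (X : Matrix (Fin m) (Fin n) ℝ) : ℝ :=
  sigmaMax X / sigmaMin X

/-- Largest eigenvalue of a symmetric matrix, via the Rayleigh quotient. -/
noncomputable def lamMax {r : ℕ} (C : Matrix (Fin r) (Fin r) ℝ) : ℝ :=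
  sSup {c : ℝ | ∃ v : Fin r → ℝ, colNorm v = 1 ∧ c = v ⬝ᵥ C.mulVec v}

/-- Smallest eigenvalue of a symmetric matrix, via the Rayleigh quotient. -/
noncomputable def lamMin {r : ℕ} (C : Matrix (Fin r) (Fin r) ℝ) : ℝ :=
  sInf {c : ℝ | ∃ v : Fin r → ℝ, colNorm v = 1 ∧ c = v ⬝ᵥ C.mulVec v}

/-- Near-separable assumption with `m = r`: `Mt = W * H + N` where `W ∈ ℝ^{r×r}` is
invertible, `H = [I_r, H']` is nonnegative with column sums at most one and whose first `r`
columns form the identity matrix, and each column of `N` has Euclidean norm at most `ε`. -/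
def NearSepSquare (r n : ℕ) (W : Matrix (Fin r) (Fin r) ℝ) (H : Matrix (Fin r) (Fin n) ℝ)
    (N Mt : Matrix (Fin r) (Fin n) ℝ) (ε : ℝ) : Prop :=
  IsUnit W.det ∧ Mt = W * H + N ∧ (∀ i j, 0 ≤ H i j) ∧ (∀ j, ∑ i, H i j ≤ 1) ∧
    (∃ h : r ≤ n, ∀ i j : Fin r, H i (Fin.castLE h j) = if i = j then 1 else 0) ∧
    0 ≤ ε ∧ ∀ j, colNorm (fun i => N i j) ≤ ε

/-- `A` is feasible for the minimum-volume-ellipsoid SDP associated with `Mt`: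
`A` is positive semidefinite and `m̃ᵢᵀ A m̃ᵢ ≤ 1` for every column `m̃ᵢ` of `Mt`. -/
def SDPFeasible {r n : ℕ} (Mt : Matrix (Fin r) (Fin n) ℝ)
    (A : Matrix (Fin r) (Fin r) ℝ) : Prop :=
  A.PosSemidef ∧ ∀ j : Fin n, (fun i => Mt i j) ⬝ᵥ A.mulVec (fun i => Mt i j) ≤ 1

/-- `A` is an optimal solution of the minimum-volume-ellipsoid SDP associated with `Mt`:
it is feasible and maximizes the determinant among the feasible matrices. -/
def SDPOptimal {r n : ℕ} (Mt : Matrix (Fin r) (Fin n) ℝ)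
    (A : Matrix (Fin r) (Fin r) ℝ) : Prop :=
  SDPFeasible Mt A ∧ ∀ B : Matrix (Fin r) (Fin r) ℝ, SDPFeasible Mt B → B.det ≤ A.det

theorem colNorm_sq {m : ℕ} (v : Fin m → ℝ) : colNorm v ^ 2 = v ⬝ᵥ v := by
  rw [colNorm, Real.sq_sqrt (Finset.sum_nonneg fun i _ => sq_nonneg _)]
  simp [dotProduct, sq]

theorem colNorm_nonneg {m : ℕ} (v : Fin m → ℝ) : 0 ≤ colNorm v := Real.sqrt_nonneg _

theorem colNorm_single {m : ℕ} (i : Fin m) : colNorm (Pi.single i (1 : ℝ)) = 1 := by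
  simp [colNorm, Pi.single_apply]

theorem colNorm_smul {m : ℕ} (c : ℝ) (v : Fin m → ℝ) : colNorm (c • v) = |c| * colNorm v := by
  simp only [colNorm, Pi.smul_apply, smul_eq_mul, mul_pow, ← Finset.mul_sum]
  rw [Real.sqrt_mul (sq_nonneg c), Real.sqrt_sq_eq_abs]

/-- The operator norm of a matrix is bounded by its Frobenius norm. -/
theorem colNorm_mulVec_le {m n : ℕ} (X : Matrix (Fin m) (Fin n) ℝ) (v : Fin n → ℝ) :
    colNorm (X.mulVec v) ≤ Real.sqrt (∑ i, ∑ j, X i j ^ 2) * colNorm v := by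
  rw [colNorm, colNorm, ← Real.sqrt_mul (by positivity), Finset.sum_mul]
  exact Real.sqrt_le_sqrt
    (Finset.sum_le_sum fun i _ => Finset.sum_mul_sq_le_sq_mul_sq Finset.univ (X i) v)

theorem sigmaMin_mul_colNorm_le {m n : ℕ} (X : Matrix (Fin m) (Fin n) ℝ) (v : Fin n → ℝ) :
    sigmaMin X * colNorm v ≤ colNorm (X.mulVec v) := by
  rcases (colNorm_nonneg v).eq_or_lt with h0 | h0
  · rw [← h0, mul_zero]
    exact colNorm_nonneg _
  · have h : sigmaMin X ≤ colNorm (X.mulVec ((colNorm v)⁻¹ • v)) := by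
      refine csInf_le ⟨0, ?_⟩ ⟨_, ?_, rfl⟩
      · rintro _ ⟨w, -, rfl⟩
        exact colNorm_nonneg _
      · rw [colNorm_smul, abs_of_pos (inv_pos.2 h0), inv_mul_cancel₀ h0.ne']
    rw [mulVec_smul, colNorm_smul, abs_of_pos (inv_pos.2 h0), inv_mul_eq_div] at h
    exact (le_div_iff₀ h0).1 h

theorem sigmaMin_pos {r : ℕ} [NeZero r] {W : Matrix (Fin r) (Fin r) ℝ} (hW : IsUnit W.det) :
    0 < sigmaMin W := by
  set K := Real.sqrt (∑ i, ∑ j, W⁻¹ i j ^ 2)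
  have key (v : Fin r → ℝ) (hv : colNorm v = 1) : 1 ≤ K * colNorm (W.mulVec v) := by
    simpa [nonsing_inv_mul W hW, hv] using colNorm_mulVec_le W⁻¹ (W.mulVec v)
  have hK : 0 < K := (Real.sqrt_nonneg _).lt_of_ne' fun h => by
    have := key _ (colNorm_single (0 : Fin r))
    rw [show K = 0 from h] at this
    linarith
  refine (inv_pos.2 hK).trans_le (le_csInf ⟨_, _, colNorm_single (0 : Fin r), rfl⟩ ?_)
  rintro _ ⟨v, hv, rfl⟩
  exact (inv_le_iff_one_le_mul₀' hK).2 (key v hv)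

/-- A weighted triangle inequality for positive semidefinite quadratic forms. -/
theorem Matrix.PosSemidef.dotProduct_mulVec_add_le {n : Type*} [Fintype n]
    {C : Matrix n n ℝ} (hC : C.PosSemidef) {s : ℝ} (hs : 0 < s) (y z : n → ℝ) :
    (y + z) ⬝ᵥ C *ᵥ (y + z) ≤ (1 + 1 / s) * (y ⬝ᵥ C *ᵥ y) + (1 + s) * (z ⬝ᵥ C *ᵥ z) := by
  have h := hC.dotProduct_mulVec_nonneg (y - s • z)
  simp only [star_trivial, mulVec_sub, mulVec_smul, dotProduct_sub, sub_dotProduct,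
    smul_dotProduct, dotProduct_smul, smul_eq_mul] at h
  simp only [mulVec_add, dotProduct_add, add_dotProduct]
  have h' := mul_nonneg (one_div_pos.2 hs).le h
  have hs' : 1 / s * s = 1 := one_div_mul_cancel hs.ne'
  have : 1 / s * (y ⬝ᵥ C *ᵥ y - s * (z ⬝ᵥ C *ᵥ y) - s * (y ⬝ᵥ C *ᵥ z - s * (z ⬝ᵥ C *ᵥ z))) =
      1 / s * (y ⬝ᵥ C *ᵥ y) - z ⬝ᵥ C *ᵥ y - y ⬝ᵥ C *ᵥ z + s * (z ⬝ᵥ C *ᵥ z) := by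
    field_simp
    ring
  linarith

/-- An upper bound for the eigenvalues bounds the quadratic form. -/
theorem Matrix.IsHermitian.dotProduct_mulVec_le {n : Type*} [Fintype n] [DecidableEq n]
    {C : Matrix n n ℝ} (hC : C.IsHermitian) {t : ℝ} (ht : ∀ i, hC.eigenvalues i ≤ t)
    (v : n → ℝ) : v ⬝ᵥ C *ᵥ v ≤ t * (v ⬝ᵥ v) := by
  have hD : (diagonal fun i => t - hC.eigenvalues i).PosSemidef :=
    PosSemidef.diagonal fun i => sub_nonneg.2 (ht i)
  have h := (hD.mul_mul_conjTranspose_same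
    (hC.eigenvectorUnitary : Matrix n n ℝ)).dotProduct_mulVec_nonneg v
  have hsub : (hC.eigenvectorUnitary : Matrix n n ℝ) * (diagonal fun i => t - hC.eigenvalues i) *
      (hC.eigenvectorUnitary : Matrix n n ℝ)ᴴ = t • 1 - C := by
    have hU : (hC.eigenvectorUnitary : Matrix n n ℝ) * (hC.eigenvectorUnitary : Matrix n n ℝ)ᴴ
        = 1 := Unitary.coe_mul_star_self _
    have hs : C = (hC.eigenvectorUnitary : Matrix n n ℝ) * diagonal hC.eigenvalues *
        (hC.eigenvectorUnitary : Matrix n n ℝ)ᴴ := hC.spectral_theorem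
    have hd : (diagonal fun i => t - hC.eigenvalues i) = t • 1 - diagonal hC.eigenvalues := by
      rw [smul_one_eq_diagonal, diagonal_sub]
    rw [hd, mul_sub, sub_mul, ← hs, mul_smul_comm, smul_mul_assoc, mul_one, hU]
  rw [hsub] at h
  simpa [sub_mulVec, smul_mulVec, dotProduct_sub] using h

theorem Matrix.PosSemidef.eigenvalues_le_trace {n : Type*} [Fintype n] [DecidableEq n]
    {C : Matrix n n ℝ} (hC : C.PosSemidef) (k : n) : hC.1.eigenvalues k ≤ C.trace := by
  rw [hC.1.trace_eq_sum_eigenvalues]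
  exact Finset.single_le_sum (f := fun i => hC.1.eigenvalues i)
    (fun i _ => hC.eigenvalues_nonneg i) (Finset.mem_univ k)

theorem Matrix.PosSemidef.det_le_two_mul_exp {n : Type*} [Fintype n] [DecidableEq n]
    {C : Matrix n n ℝ} (hC : C.PosSemidef) (k : n) :
    C.det ≤ 2 * Real.exp (C.trace - Fintype.card n - hC.1.eigenvalues k / 2) := by
  set l := hC.1.eigenvalues with hl
  have h0 (i : n) : 0 ≤ l i := hC.eigenvalues_nonneg i
  have hexp (x : ℝ) : x ≤ Real.exp (x - 1) := by linarith [Real.add_one_le_exp (x - 1)]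
  have hk : l k ≤ 2 * Real.exp (l k / 2 - 1) := by linarith [hexp (l k / 2)]
  have hprod : ∏ i ∈ Finset.univ.erase k, l i ≤
      Real.exp (∑ i ∈ Finset.univ.erase k, (l i - 1)) := by
    rw [Real.exp_sum]
    exact Finset.prod_le_prod (fun i _ => h0 i) fun i _ => hexp (l i)
  have hsum : ∑ i ∈ Finset.univ.erase k, (l i - 1) = C.trace - Fintype.card n - (l k - 1) := by
    rw [Finset.sum_erase_eq_sub (Finset.mem_univ k), hC.1.trace_eq_sum_eigenvalues]
    simp [hl]
  have hdet : C.det = l k * ∏ i ∈ Finset.univ.erase k, l i := by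
    rw [Finset.mul_prod_erase _ _ (Finset.mem_univ k), hC.1.det_eq_prod_eigenvalues]
    simp [hl]
  rw [hdet]
  calc _ ≤ 2 * Real.exp (l k / 2 - 1) * Real.exp (C.trace - Fintype.card n - (l k - 1)) :=
        mul_le_mul hk (hsum ▸ hprod) (Finset.prod_nonneg fun i _ => h0 i) (by positivity)
    _ = _ := by
        rw [mul_assoc, ← Real.exp_add]
        ring_nf

/-- If the ellipsoid of `C` contains small perturbations of all the unit vectors, then the trace
of `C` is only slightly larger than its dimension. -/
theorem Matrix.PosSemidef.trace_le_add_half {r : ℕ} (hr : 2 ≤ r)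
    {C : Matrix (Fin r) (Fin r) ℝ} (hC : C.PosSemidef) (d : Fin r → Fin r → ℝ)
    (hd : ∀ i, d i ⬝ᵥ d i ≤ 1 / (64 * (r : ℝ) ^ 3))
    (hfeas : ∀ i, (Pi.single i 1 + d i) ⬝ᵥ C *ᵥ (Pi.single i 1 + d i) ≤ 1) :
    C.trace ≤ r + 1 / 2 := by
  have hr' : (2 : ℝ) ≤ r := by exact_mod_cast hr
  have hT : 0 ≤ C.trace := hC.trace_nonneg
  have hdiag (i : Fin r) :
      C i i ≤ (1 + 1 / (8 * r)) + (1 + 8 * r) * (C.trace * (1 / (64 * (r : ℝ) ^ 3))) := by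
    have h := hC.dotProduct_mulVec_add_le (s := 8 * r) (by positivity)
      (Pi.single i 1 + d i) (-d i)
    rw [add_neg_cancel_right, mulVec_neg, neg_dotProduct_neg] at h
    have h1 : (Pi.single i 1 : Fin r → ℝ) ⬝ᵥ C *ᵥ Pi.single i 1 = C i i := by simp
    have h2 := hC.1.dotProduct_mulVec_le hC.eigenvalues_le_trace (d i)
    have h3 := mul_le_mul_of_nonneg_left (hd i) hT
    rw [h1] at h
    refine h.trans (add_le_add ?_ ?_)
    · exact mul_le_of_le_one_right (by positivity) (hfeas i)
    · exact mul_le_mul_of_nonneg_left (h2.trans h3) (by positivity)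
  have hsum : C.trace ≤
      r * ((1 + 1 / (8 * r)) + (1 + 8 * r) * (C.trace * (1 / (64 * (r : ℝ) ^ 3)))) := by
    refine (Finset.sum_le_sum fun i _ => hdiag i).trans_eq ?_
    rw [Finset.sum_const, Finset.card_univ, Fintype.card_fin, nsmul_eq_mul]
  have heq : r * ((1 + 1 / (8 * r)) + (1 + 8 * r) * (C.trace * (1 / (64 * (r : ℝ) ^ 3)))) =
      r + 1 / 8 + (1 + 8 * r) / (64 * (r : ℝ) ^ 2) * C.trace := by
    field_simp
  have hq : (1 + 8 * r) / (64 * (r : ℝ) ^ 2) ≤ 17 / (128 * r) := by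
    rw [div_le_div_iff₀ (by positivity) (by positivity)]
    nlinarith
  by_contra! hlt
  have h17 : 17 / (128 * (r : ℝ)) ≤ 17 / 256 := by
    rw [div_le_div_iff₀ (by positivity) (by positivity)]
    linarith
  have hle : C.trace ≤ r + 1 / 8 + 17 / (128 * r) * C.trace := by
    linarith [mul_le_mul_of_nonneg_right hq hT]
  have hT2 : C.trace ≤ 5 / 4 * r := by
    linarith [mul_le_mul_of_nonneg_right h17 hT]
  have hfin : 17 / (128 * (r : ℝ)) * C.trace ≤ 17 / (128 * r) * (5 / 4 * r) :=
    mul_le_mul_of_nonneg_left hT2 (by positivity)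
  have : 17 / (128 * (r : ℝ)) * (5 / 4 * r) = 85 / 512 := by
    field_simp
    norm_num
  linarith

theorem dotProduct_self_le_one_of_sum_le_one {r : ℕ} {h : Fin r → ℝ} (h0 : ∀ i, 0 ≤ h i)
    (h1 : ∑ i, h i ≤ 1) : h ⬝ᵥ h ≤ 1 := by
  refine (Finset.sum_le_sum fun i hi => ?_).trans h1
  exact mul_le_of_le_one_right (h0 i)
    ((Finset.single_le_sum (fun j _ => h0 j) hi).trans h1)

theorem exp_neg_quarter_le {r : ℕ} (hr : 0 < r) :
    Real.exp (-(1 / 4)) ≤ ((1 + 1 / (4 * r) : ℝ)⁻¹) ^ r := by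
  have hr' : (0 : ℝ) < r := by exact_mod_cast hr
  rw [Real.exp_neg, inv_pow]
  refine inv_anti₀ (by positivity) ?_
  calc (1 + 1 / (4 * r) : ℝ) ^ r ≤ Real.exp (1 / (4 * r)) ^ r :=
        pow_le_pow_left₀ (by positivity) (by linarith [Real.add_one_le_exp (1 / (4 * r) : ℝ)]) _
    _ = Real.exp (1 / 4) := by
        rw [← Real.exp_nat_mul]
        congr 1
        field_simp

/-- Points of the simplex, slightly perturbed, lie in a ball of radius slightly above one. -/
theorem dotProduct_add_self_le {r : ℕ} (hr : 2 ≤ r) {h d : Fin r → ℝ} (hh : h ⬝ᵥ h ≤ 1)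
    (hd : d ⬝ᵥ d ≤ 1 / (64 * (r : ℝ) ^ 3)) : (h + d) ⬝ᵥ (h + d) ≤ 1 + 1 / (4 * r) := by
  have hr' : (2 : ℝ) ≤ r := by exact_mod_cast hr
  have hq := (PosSemidef.one (n := Fin r) (R := ℝ)).dotProduct_mulVec_add_le (s := 8 * r)
    (by positivity) h d
  simp only [one_mulVec] at hq
  have h1 : (1 + 1 / (8 * r)) * (h ⬝ᵥ h) ≤ 1 + 1 / (8 * (r : ℝ)) :=
    mul_le_of_le_one_right (by positivity) hh
  have h2 : (1 + 8 * r) * (d ⬝ᵥ d) ≤ (1 + 8 * r) * (1 / (64 * (r : ℝ) ^ 3)) :=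
    mul_le_mul_of_nonneg_left hd (by positivity)
  have h3 : (1 + 8 * r) * (1 / (64 * (r : ℝ) ^ 3)) ≤ 1 / (8 * r) := by
    rw [mul_one_div, div_le_div_iff₀ (by positivity) (by positivity)]
    have : 0 ≤ (r : ℝ) * (8 * r ^ 2 - 8 * r - 1) := mul_nonneg (by positivity) (by nlinarith)
    nlinarith
  have h4 : 1 / (4 * (r : ℝ)) = 1 / (8 * r) + 1 / (8 * r) := by
    field_simp
    norm_num
  linarith

theorem colNorm_sq_le_of_sigmaMin {r : ℕ} (hr : 2 ≤ r) {W : Matrix (Fin r) (Fin r) ℝ}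
    (hW : IsUnit W.det) {ε : ℝ} (hε : ε ≤ sigmaMin W / (8 * r * Real.sqrt r)) {d : Fin r → ℝ}
    (hd : colNorm (W *ᵥ d) ≤ ε) : d ⬝ᵥ d ≤ 1 / (64 * (r : ℝ) ^ 3) := by
  have : NeZero r := ⟨by omega⟩
  have hr' : (0 : ℝ) < r := by exact_mod_cast (by omega : 0 < r)
  have h := ((sigmaMin_mul_colNorm_le W d).trans hd).trans hε
  rw [div_eq_mul_one_div] at h
  have h' := le_of_mul_le_mul_left h (sigmaMin_pos hW)
  rw [← colNorm_sq]
  refine (pow_le_pow_left₀ (colNorm_nonneg d) h' 2).trans_eq ?_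
  rw [div_pow, mul_pow, Real.sq_sqrt hr'.le]
  ring

/-- If `r ≥ 2` and `ε ≤ σ_min(W)/(8 r √r)`, then any optimal solution `A*` of the
minimum-volume-ellipsoid SDP satisfies `λ_max(Wᵀ A* W) ≤ 4`. -/
theorem lamMax_upper_bound (r n : ℕ) (W : Matrix (Fin r) (Fin r) ℝ)
    (H : Matrix (Fin r) (Fin n) ℝ) (N Mt : Matrix (Fin r) (Fin n) ℝ) (ε : ℝ)
    (A : Matrix (Fin r) (Fin r) ℝ)
    (hr : 2 ≤ r) (hsep : NearSepSquare r n W H N Mt ε)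
    (hε : ε ≤ sigmaMin W / (8 * r * Real.sqrt r)) (hA : SDPOptimal Mt A) :
    lamMax (Wᵀ * A * W) ≤ 4 := by
  obtain ⟨hW, hMt, hH0, hH1, ⟨hrn, hHI⟩, -, hN⟩ := hsep
  have hr' : (0 : ℝ) < r := by exact_mod_cast (by omega : 0 < r)
  set d : Fin n → Fin r → ℝ := fun j => W⁻¹ *ᵥ fun i => N i j with hd_def
  have hWd (j : Fin n) : W *ᵥ d j = fun i => N i j := by
    rw [hd_def, mulVec_mulVec, mul_nonsing_inv W hW, one_mulVec]
  have hd (j : Fin n) : d j ⬝ᵥ d j ≤ 1 / (64 * (r : ℝ) ^ 3) :=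
    colNorm_sq_le_of_sigmaMin hr hW hε ((hWd j).symm ▸ hN j)
  have hcol (j : Fin n) : (fun i => Mt i j) = W *ᵥ ((fun i => H i j) + d j) := by
    rw [mulVec_add, hWd, hMt]
    ext i
    simp [mul_apply, mulVec, dotProduct]
  have hquad (B : Matrix (Fin r) (Fin r) ℝ) (x : Fin r → ℝ) :
      (W *ᵥ x) ⬝ᵥ B *ᵥ (W *ᵥ x) = x ⬝ᵥ (Wᵀ * B * W) *ᵥ x := by
    rw [← mulVec_mulVec, ← mulVec_mulVec, dotProduct_mulVec x Wᵀ, vecMul_transpose]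
  obtain ⟨⟨hApsd, hAfeas⟩, hAopt⟩ := hA
  set C := Wᵀ * A * W with hC_def
  have hC : C.PosSemidef := by
    simpa using hApsd.conjTranspose_mul_mul_same W
  have hCtrace : C.trace ≤ r + 1 / 2 := by
    refine hC.trace_le_add_half hr (fun i => d (Fin.castLE hrn i)) (fun i => hd _) fun i => ?_
    have h := hAfeas (Fin.castLE hrn i)
    rw [hcol, hquad] at h
    convert h using 3 <;> (ext k; simp [hHI, Pi.single_apply])
  have hCdet : Real.exp (-(1 / 4)) ≤ C.det := by
    set c : ℝ := (1 + 1 / (4 * r))⁻¹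
    have hc : 0 < c := by positivity
    set B : Matrix (Fin r) (Fin r) ℝ := c • (W⁻¹ᵀ * W⁻¹)
    have hWB : Wᵀ * B * W = c • 1 := by
      rw [mul_smul_comm, smul_mul_assoc, ← mul_assoc, ← transpose_mul, mul_assoc,
        nonsing_inv_mul W hW, transpose_one, one_mul]
    have hB : SDPFeasible Mt B := by
      refine ⟨(by simpa using posSemidef_conjTranspose_mul_self W⁻¹ :
        (W⁻¹ᵀ * W⁻¹).PosSemidef).smul hc.le, fun j => ?_⟩
      rw [hcol, hquad, hWB, smul_mulVec, one_mulVec, dotProduct_smul, smul_eq_mul,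
        inv_mul_le_one₀ (by positivity)]
      exact dotProduct_add_self_le hr (dotProduct_self_le_one_of_sum_le_one (fun i => hH0 i j)
        (hH1 j)) (hd j)
    have hdet : (Wᵀ * B * W).det ≤ C.det := by
      have hle := mul_le_mul_of_nonneg_left (hAopt B hB) (sq_nonneg W.det)
      simp only [hC_def, det_mul, det_transpose]
      linarith
    rw [hWB, det_smul, det_one, mul_one, Fintype.card_fin] at hdet
    exact (exp_neg_quarter_le (by omega)).trans hdet
  have hev (k : Fin r) : hC.1.eigenvalues k ≤ 4 := by
    by_contra! hk
    have h1 := hCdet.trans (hC.det_le_two_mul_exp k)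
    rw [Fintype.card_fin] at h1
    have h2 : Real.exp (C.trace - r - hC.1.eigenvalues k / 2) ≤ Real.exp (-(3 / 2)) :=
      Real.exp_le_exp.2 (by linarith)
    have h3 : Real.exp (-(1 / 4)) = Real.exp (5 / 4) * Real.exp (-(3 / 2)) := by
      rw [← Real.exp_add]
      norm_num
    nlinarith [Real.add_one_le_exp (5 / 4 : ℝ), Real.exp_pos (-(3 / 2))]
  refine csSup_le ⟨_, _, colNorm_single (⟨0, by omega⟩ : Fin r), rfl⟩ ?_
  rintro _ ⟨v, hv, rfl⟩
  have h := hC.1.dotProduct_mulVec_le hev v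
  rwa [← colNorm_sq, hv, one_pow, mul_one] at h
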